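/- Let V=(Q,D,Δ,w) be a 1-VASS with disequality tests. A configuration in Conf_+ is unbounded if and only if some configuration belonging to an unbounded chain is reachable from it. Consequently, the union ⋃_{n∈ℕ} U_n equals the set Conf_∞ of all unbounded configurations in Conf_+. -/

import Mathlib

namespace VASSPaper

/-- A 1-VASS with disequality tests: states `Q`, transition relation `delta`,
integer weights `w`, and for each state a cofinite set `D q ⊆ ℕ` of allowed counter values. -/
structure OneVASS (Q : Type) where
  delta : Q → Q → Prop
  w : Q → Q → ℤ
  D : Q → Set ℕ
  cofinite : ∀ q, (D q)ᶜ.Finite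

variable {Q : Type}

/-- A path is a nonempty sequence of states joined by transitions. -/
def IsPath (V : OneVASS Q) : List Q → Prop
  | [] => False
  | [_] => True
  | a :: b :: l => V.delta a b ∧ IsPath V (b :: l)

/-- The weight of a path: the sum of the weights of its transitions. -/
def pathWeight (V : OneVASS Q) (π : List Q) : ℤ :=
  (List.zipWith V.w π π.tail).sum

/-- The counter value at position `i` of the run over `π` starting with counter `z`. -/
def counterAt (V : OneVASS Q) (z : ℕ) (π : List Q) (i : ℕ) : ℤ :=
  (z : ℤ) + pathWeight V (π.take (i + 1))

/-- `π` lifts to a run from counter value `z`: all counter values stay nonnegative. -/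
def IsRun (V : OneVASS Q) (π : List Q) (z : ℕ) : Prop :=
  IsPath V π ∧ ∀ i, i < π.length → 0 ≤ counterAt V z π i

/-- A valid run additionally respects all disequality guards. -/
def IsValidRun (V : OneVASS Q) (π : List Q) (z : ℕ) : Prop :=
  IsRun V π z ∧ ∀ i, ∀ h : i < π.length, (counterAt V z π i).toNat ∈ V.D (π.get ⟨i, h⟩)

/-- `π` goes from configuration `c` to configuration `c'`. -/
def RunFromTo (V : OneVASS Q) (π : List Q) (c c' : Q × ℕ) : Prop :=
  π.head? = some c.1 ∧ π.getLast? = some c'.1 ∧ (c'.2 : ℤ) = (c.2 : ℤ) + pathWeight V π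

/-- `c'` is reachable from `c` by a valid run. -/
def Reaches (V : OneVASS Q) (c c' : Q × ℕ) : Prop :=
  ∃ π, IsValidRun V π c.2 ∧ RunFromTo V π c c'

/-- A configuration is unbounded if infinitely many configurations are reachable from it. -/
def Unbounded (V : OneVASS Q) (c : Q × ℕ) : Prop :=
  {c' | Reaches V c c'}.Infinite

/-- `(s,0)` covers the state `t`. -/
def Covers (V : OneVASS Q) (s t : Q) : Prop :=
  ∃ z, Reaches V (s, 0) (t, z)

/-- Every state has at most one disequality guard. -/
def SingleGuard (V : OneVASS Q) : Prop :=
  ∀ q, V.D q = Set.univ ∨ ∃ g : ℕ, V.D q = {g}ᶜ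

/-- The minimum weight of a (possibly empty) prefix of `π`. -/
def pmin (V : OneVASS Q) (π : List Q) : ℤ :=
  ((List.range (π.length + 1)).map fun i => pathWeight V (π.take i)).foldr min 0

/-- The maximum weight of a (possibly empty) suffix of `π`. -/
def smax (V : OneVASS Q) (π : List Q) : ℤ :=
  ((List.range (π.length + 1)).map fun i => pathWeight V (π.drop i)).foldr max 0

/-- A cycle on `q`: a path with at least one transition starting and ending at `q`. -/
def IsCycleOn (V : OneVASS Q) (π : List Q) (q : Q) : Prop :=
  IsPath V π ∧ 2 ≤ π.length ∧ π.head? = some q ∧ π.getLast? = some q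

/-- A simple cycle on `q`. -/
def IsSimpleCycleOn (V : OneVASS Q) (π : List Q) (q : Q) : Prop :=
  IsCycleOn V π q ∧ π.dropLast.Nodup

/-- The set of states lying on a positive-weight simple cycle. -/
def Qplus (V : OneVASS Q) : Set Q :=
  {q | ∃ π, IsSimpleCycleOn V π q ∧ 0 < pathWeight V π}

/-- `γ` is a valid choice of cycles: for each `q ∈ Q₊`, `γ q` is a simple positive cycle
on `q` whose `pmin` is maximal among all positive-weight simple cycles on `q`. -/
def GammaChoice (V : OneVASS Q) (γ : Q → List Q) : Prop :=
  ∀ q ∈ Qplus V,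
    IsSimpleCycleOn V (γ q) q ∧ 0 < pathWeight V (γ q) ∧
      ∀ π, IsSimpleCycleOn V π q → 0 < pathWeight V π → pmin V π ≤ pmin V (γ q)

/-- `Conf₊`: configurations `(q,z)` with `q ∈ Q₊` and `z + pmin (γ q) ≥ 0`. -/
def ConfPlus (V : OneVASS Q) (γ : Q → List Q) : Set (Q × ℕ) :=
  {c | c.1 ∈ Qplus V ∧ 0 ≤ (c.2 : ℤ) + pmin V (γ c.1)}

/-- `W_q`, the weight of the chosen cycle `γ q`, as a natural number. -/
def Wnat (V : OneVASS Q) (γ : Q → List Q) (q : Q) : ℕ :=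
  (pathWeight V (γ q)).toNat

/-- The `q`-residue class of `r` modulo `W_q`. -/
def resClass (V : OneVASS Q) (γ : Q → List Q) (q : Q) (r : ℕ) : Set (Q × ℕ) :=
  {c | c ∈ ConfPlus V γ ∧ c.1 = q ∧ c.2 % Wnat V γ q = r}

/-- `iterCycle π k` is the cycle `π` iterated `k+1` times. -/
def iterCycle (π : List Q) : ℕ → List Q
  | 0 => π
  | k + 1 => iterCycle π k ++ π.tail

/-- Counter values `z < z'` at state `q` are connected by a valid run iterating `γ q`. -/
def chainLinked (V : OneVASS Q) (γ : Q → List Q) (q : Q) (z z' : ℕ) : Prop :=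
  ∃ k, IsValidRun V (iterCycle (γ q) k) z ∧
    (z' : ℤ) = (z : ℤ) + pathWeight V (iterCycle (γ q) k)

/-- Any two configurations of `S` are connected by iterating `γ q`. -/
def ChainCond (V : OneVASS Q) (γ : Q → List Q) (q : Q) (S : Set (Q × ℕ)) : Prop :=
  ∀ c ∈ S, ∀ c' ∈ S, c.2 < c'.2 → chainLinked V γ q c.2 c'.2

/-- A `q`-chain inside the `q`-residue class of `r`: a maximal subset whose
configurations are pairwise connected by iterating `γ q`. -/
def IsChainIn (V : OneVASS Q) (γ : Q → List Q) (q : Q) (r : ℕ) (C : Set (Q × ℕ)) : Prop :=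
  C ⊆ resClass V γ q r ∧ ChainCond V γ q C ∧
    ∀ C', C ⊆ C' → C' ⊆ resClass V γ q r → ChainCond V γ q C' → C' = C

/-- A chain (in some residue class of some state of `Q₊`). -/
def IsChain (V : OneVASS Q) (γ : Q → List Q) (C : Set (Q × ℕ)) : Prop :=
  ∃ q r, q ∈ Qplus V ∧ r < Wnat V γ q ∧ IsChainIn V γ q r C

/-- A set of configurations is bounded if its counter values are bounded. -/
def chainBounded (C : Set (Q × ℕ)) : Prop :=
  BddAbove (Prod.snd '' C)

/-- A residue class is trivial if it consists of a single unbounded chain. -/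
def TrivialClass (V : OneVASS Q) (γ : Q → List Q) (q : Q) (r : ℕ) : Prop :=
  IsChainIn V γ q r (resClass V γ q r) ∧ ¬ chainBounded (resClass V γ q r)

/-- There is a valid run of length `k` (i.e. `k` transitions) from `c` into the set `S`. -/
def RunLenTo (V : OneVASS Q) (c : Q × ℕ) (S : Set (Q × ℕ)) (k : ℕ) : Prop :=
  ∃ π c', c' ∈ S ∧ IsValidRun V π c.2 ∧ RunFromTo V π c c' ∧ π.length = k + 1

/-- Configurations of `Conf₊ \ Un` whose distance to `Un` is minimal among all
configurations of `Conf₊ \ Un`. -/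
def Uprime (V : OneVASS Q) (γ : Q → List Q) (Un : Set (Q × ℕ)) : Set (Q × ℕ) :=
  {c | c ∈ ConfPlus V γ \ Un ∧
    ∃ k, RunLenTo V c Un k ∧
      ∀ c' ∈ ConfPlus V γ \ Un, ∀ j, RunLenTo V c' Un j → k ≤ j}

/-- `S` is downward closed in every chain. -/
def dcClosed (V : OneVASS Q) (γ : Q → List Q) (S : Set (Q × ℕ)) : Prop :=
  ∀ C, IsChain V γ C → ∀ c ∈ S ∩ C, ∀ c' ∈ C, c'.2 ≤ c.2 → c' ∈ S

/-- The inductive sequence `U_n`: `U_0` is the union of the unbounded chains; `U_{n+1}` is the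
smallest superset of `U_n ∪ U'_n` that is downward closed in every chain. -/
def U (V : OneVASS Q) (γ : Q → List Q) : ℕ → Set (Q × ℕ)
  | 0 => ⋃₀ {C | IsChain V γ C ∧ ¬ chainBounded C}
  | n + 1 => ⋂₀ {S | U V γ n ∪ Uprime V γ (U V γ n) ⊆ S ∧ dcClosed V γ S}

/-- `C` is an `n`-active bounded chain in the `q`-residue class of `r`. -/
def nActiveIn (V : OneVASS Q) (γ : Q → List Q) (q : Q) (r : ℕ) (n : ℕ)
    (C : Set (Q × ℕ)) : Prop :=
  IsChainIn V γ q r C ∧ chainBounded C ∧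
    ∃ c ∈ U V γ n ∩ resClass V γ q r, ∃ c' ∈ C, c.2 ≤ c'.2

/-- `δ_n(C)` for a `q`-chain `C`: configurations outside `U_n` whose counter value lies
between two counter values of `C \ U_n`. -/
def deltaC (V : OneVASS Q) (γ : Q → List Q) (n : ℕ) (q : Q) (C : Set (Q × ℕ)) :
    Set (Q × ℕ) :=
  {c | c ∈ ConfPlus V γ ∧ c.1 = q ∧ c ∉ U V γ n ∧
    ∃ z₁ z₂, (q, z₁) ∈ C \ U V γ n ∧ (q, z₂) ∈ C \ U V γ n ∧ z₁ ≤ c.2 ∧ c.2 ≤ z₂}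

/-- `δ_n(R)` for the `q`-residue class `R` of `r`: union of `δ_n(C)` over `n`-active chains. -/
def deltaR (V : OneVASS Q) (γ : Q → List Q) (n : ℕ) (q : Q) (r : ℕ) : Set (Q × ℕ) :=
  {c | ∃ C, nActiveIn V γ q r n C ∧ c ∈ deltaC V γ n q C}

/-- A positive-weight cycle (as a list of states). -/
def IsPosCycle (V : OneVASS Q) (π : List Q) : Prop :=
  2 ≤ π.length ∧ π.head? = π.getLast? ∧ 0 < pathWeight V π

/-- A path is primitive if no proper infix of it is a positive-weight cycle. -/
def Primitive (V : OneVASS Q) (π : List Q) : Prop :=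
  ∀ i l, (π.drop i).take l ≠ π → ¬ IsPosCycle V ((π.drop i).take l)

lemma pathWeight_singleton (V : OneVASS Q) (a : Q) : pathWeight V [a] = 0 := by
  simp [pathWeight]

lemma pathWeight_cons_cons (V : OneVASS Q) (a b : Q) (l : List Q) :
    pathWeight V (a :: b :: l) = V.w a b + pathWeight V (b :: l) := by
  simp [pathWeight]

lemma pathWeight_append (V : OneVASS Q) (l : List Q) (a : Q) (m : List Q) :
    pathWeight V (l ++ a :: m) = pathWeight V (l ++ [a]) + pathWeight V (a :: m) := by
  induction l with
  | nil => simp [pathWeight_singleton]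
  | cons b l ih =>
    cases l with
    | nil => simp [pathWeight_cons_cons, pathWeight_singleton]
    | cons c l =>
      simp only [List.cons_append, pathWeight_cons_cons] at ih ⊢
      rw [ih]
      ring

lemma isPath_iff (V : OneVASS Q) (π : List Q) :
    IsPath V π ↔ π ≠ [] ∧ π.IsChain V.delta := by
  induction π with
  | nil => simp [IsPath]
  | cons a l ih =>
    cases l with
    | nil => simp [IsPath]
    | cons b l => simpa [IsPath] using fun _ => by simpa using ih

lemma isValidRun_singleton (V : OneVASS Q) (a : Q) (z : ℕ) :
    IsValidRun V [a] z ↔ z ∈ V.D a := by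
  simp [IsValidRun, IsRun, IsPath, counterAt, pathWeight_singleton]

lemma isValidRun_cons_cons (V : OneVASS Q) (a b : Q) (l : List Q) (z : ℕ) :
    IsValidRun V (a :: b :: l) z ↔
      z ∈ V.D a ∧ V.delta a b ∧ ∃ z' : ℕ, (z' : ℤ) = z + V.w a b ∧ IsValidRun V (b :: l) z' := by
  have shift : ∀ (z' : ℕ), (z' : ℤ) = z + V.w a b → ∀ i,
      counterAt V z (a :: b :: l) (i + 1) = counterAt V z' (b :: l) i := by
    intro z' hz' i
    simp only [counterAt, List.take_succ_cons, pathWeight_cons_cons]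
    rw [hz']
    ring
  have zero : counterAt V z (a :: b :: l) 0 = z := by
    simp [counterAt, pathWeight_singleton]
  constructor
  · rintro ⟨⟨⟨hab, hp⟩, hn⟩, hv⟩
    have h1 : 0 ≤ (z : ℤ) + V.w a b := by
      simpa [counterAt, pathWeight_cons_cons, pathWeight_singleton] using hn 1 (by simp)
    obtain ⟨z', hz'⟩ := Int.eq_ofNat_of_zero_le h1
    refine ⟨by simpa [zero] using hv 0 (by simp), hab, z', hz'.symm, ⟨hp, fun i hi => ?_⟩,
      fun i hi => ?_⟩
    · rw [← shift z' hz'.symm]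
      exact hn (i + 1) (by simpa using hi)
    · rw [← shift z' hz'.symm]
      exact hv (i + 1) (by simpa using hi)
  · rintro ⟨hz, hab, z', hz', ⟨hp, hn⟩, hv⟩
    refine ⟨⟨⟨hab, hp⟩, fun i hi => ?_⟩, fun i hi => ?_⟩
    · cases i with
      | zero => simp [zero]
      | succ i =>
        rw [shift z' hz']
        exact hn i (by simpa using hi)
    · cases i with
      | zero => simpa [zero] using hz
      | succ i =>
        rw [shift z' hz']
        exact hv i (by simpa using hi)

/-- Valid runs over paths sharing an endpoint can be concatenated. -/
lemma IsValidRun.append {V : OneVASS Q} {l : List Q} {a : Q} {m : List Q} {z z' : ℕ}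
    (h : IsValidRun V (l ++ [a]) z) (h' : IsValidRun V (a :: m) z')
    (hz : (z' : ℤ) = z + pathWeight V (l ++ [a])) : IsValidRun V (l ++ a :: m) z := by
  induction l generalizing z with
  | nil =>
    obtain rfl : z' = z := by simpa [pathWeight_singleton] using hz
    exact h'
  | cons b l ih =>
    cases l with
    | nil =>
      obtain ⟨hb, hd, y, hy, -⟩ := (isValidRun_cons_cons V b a [] z).1 h
      have : z' = y := by
        simp only [List.cons_append, List.nil_append, pathWeight_cons_cons,
          pathWeight_singleton] at hz
        omega
      subst this
      exact (isValidRun_cons_cons V b a m z).2 ⟨hb, hd, z', hy, h'⟩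
    | cons c l =>
      obtain ⟨hb, hd, y, hy, hr⟩ := (isValidRun_cons_cons V b c (l ++ [a]) z).1 h
      refine (isValidRun_cons_cons V b c (l ++ a :: m) z).2 ⟨hb, hd, y, hy, ih hr ?_⟩
      simp only [List.cons_append, pathWeight_cons_cons] at hz ⊢
      omega

/-- One step of a valid run. -/
def Step (V : OneVASS Q) (c c' : Q × ℕ) : Prop :=
  c.2 ∈ V.D c.1 ∧ c'.2 ∈ V.D c'.1 ∧ V.delta c.1 c'.1 ∧ (c'.2 : ℤ) = c.2 + V.w c.1 c'.1

lemma reaches_iff (V : OneVASS Q) (c c' : Q × ℕ) :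
    Reaches V c c' ↔ c.2 ∈ V.D c.1 ∧ Relation.ReflTransGen (Step V) c c' := by
  constructor
  · rintro ⟨π, hv, hh, hl, hw⟩
    induction π generalizing c with
    | nil => simp at hh
    | cons a l ih =>
      obtain ⟨q, z⟩ := c
      obtain rfl : a = q := by simpa using hh
      cases l with
      | nil =>
        obtain ⟨q', z'⟩ := c'
        obtain rfl : a = q' := by simpa using hl
        obtain rfl : z' = z := by simpa [pathWeight_singleton] using hw
        exact ⟨(isValidRun_singleton V a z').1 hv, .refl⟩
      | cons b l =>
        obtain ⟨hz, hd, y, hy, hr⟩ := (isValidRun_cons_cons V a b l z).1 hv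
        have := ih (b, y) hr (by simp) (by simpa using hl) (by
          simp only [pathWeight_cons_cons] at hw ⊢
          omega)
        exact ⟨hz, .head ⟨hz, this.1, hd, hy⟩ this.2⟩
  · rintro ⟨hc, h⟩
    induction h using Relation.ReflTransGen.head_induction_on with
    | refl =>
      exact ⟨[c'.1], (isValidRun_singleton V _ _).2 hc, by simp, by simp,
        by simp [pathWeight_singleton]⟩
    | @head a b hab _ ih =>
      obtain ⟨ha, hb, hd, hw⟩ := hab
      obtain ⟨π, hv, hh, hl, hw'⟩ := ih hb
      obtain ⟨l, rfl⟩ : ∃ l, π = b.1 :: l := by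
        cases π with
        | nil => simp at hh
        | cons x l => exact ⟨l, by simpa using hh⟩
      refine ⟨a.1 :: b.1 :: l, (isValidRun_cons_cons V _ _ _ _).2 ⟨ha, hd, b.2, hw, hv⟩,
        by simp, by simpa using hl, ?_⟩
      rw [pathWeight_cons_cons, hw', hw]
      ring

lemma Reaches.trans {V : OneVASS Q} {a b c : Q × ℕ} (h : Reaches V a b) (h' : Reaches V b c) :
    Reaches V a c := by
  rw [reaches_iff] at *
  exact ⟨h.1, h.2.trans h'.2⟩

lemma Reaches.unbounded {V : OneVASS Q} {a b : Q × ℕ} (h : Reaches V a b)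
    (hb : Unbounded V b) : Unbounded V a :=
  hb.mono fun _ hc => h.trans hc

lemma IsCycleOn.exists_eq {V : OneVASS Q} {π : List Q} {q : Q} (h : IsCycleOn V π q) :
    ∃ m, π = q :: (m ++ [q]) := by
  obtain ⟨-, hlen, hh, hl⟩ := h
  match π, hlen with
  | a :: b :: l, _ =>
    obtain rfl : a = q := by simpa using hh
    obtain ⟨m, hm⟩ := List.getLast?_eq_some_iff.1 (show (b :: l).getLast? = some a by simpa using hl)
    exact ⟨m, by rw [hm]⟩

lemma iterCycle_eq (q : Q) (m : List Q) (k : ℕ) :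
    ∃ l, iterCycle (q :: (m ++ [q])) k = q :: (l ++ [q]) := by
  induction k with
  | zero => exact ⟨m, rfl⟩
  | succ k ih =>
    obtain ⟨l, hl⟩ := ih
    exact ⟨l ++ q :: m, by simp [iterCycle, hl]⟩

lemma iterCycle_succ_eq {q : Q} {m l : List Q} {k : ℕ}
    (h : iterCycle (q :: (m ++ [q])) k = q :: (l ++ [q])) :
    iterCycle (q :: (m ++ [q])) (k + 1) = (q :: l) ++ q :: (m ++ [q]) := by
  simp [iterCycle, h]

lemma pathWeight_iterCycle (V : OneVASS Q) (q : Q) (m : List Q) (k : ℕ) :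
    pathWeight V (iterCycle (q :: (m ++ [q])) k) = (k + 1) * pathWeight V (q :: (m ++ [q])) := by
  induction k with
  | zero => simp [iterCycle]
  | succ k ih =>
    obtain ⟨l, hl⟩ := iterCycle_eq q m k
    rw [iterCycle_succ_eq hl, pathWeight_append, List.cons_append, ← hl, ih]
    push_cast
    ring

lemma isValidRun_iterCycle {V : OneVASS Q} {q : Q} {m : List Q} {z : ℕ}
    (hpos : 0 ≤ pathWeight V (q :: (m ++ [q])))
    (h : ∀ y, z ≤ y → IsValidRun V (q :: (m ++ [q])) y) (k : ℕ) :
    IsValidRun V (iterCycle (q :: (m ++ [q])) k) z := by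
  induction k with
  | zero => exact h z le_rfl
  | succ k ih =>
    obtain ⟨l, hl⟩ := iterCycle_eq q m k
    have hw := pathWeight_iterCycle V q m k
    rw [iterCycle_succ_eq hl]
    rw [hl] at ih hw
    have h0 : 0 ≤ pathWeight V (q :: (l ++ [q])) := by
      rw [hw]
      positivity
    refine IsValidRun.append (z' := z + (pathWeight V (q :: (l ++ [q]))).toNat) ih (h _ (by simp)) ?_
    simp [h0]

lemma pmin_le (V : OneVASS Q) (π : List Q) {i : ℕ} (hi : i ≤ π.length) :
    pmin V π ≤ pathWeight V (π.take i) := by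
  have aux : ∀ (l : List ℤ) (x : ℤ), x ∈ l → l.foldr min 0 ≤ x := by
    intro l x hx
    induction l with
    | nil => simp at hx
    | cons a l ih =>
      rcases List.mem_cons.1 hx with rfl | hx
      · exact min_le_left _ _
      · exact (min_le_right _ _).trans (ih hx)
  exact aux _ _ (List.mem_map.2 ⟨i, List.mem_range.2 (by omega), rfl⟩)

lemma chainLinked.reaches {V : OneVASS Q} {γ : Q → List Q} (hγ : GammaChoice V γ) {q : Q}
    (hq : q ∈ Qplus V) {z z' : ℕ} (h : chainLinked V γ q z z') : Reaches V (q, z) (q, z') := by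
  obtain ⟨k, hv, hw⟩ := h
  obtain ⟨m, hm⟩ := (hγ q hq).1.1.exists_eq
  rw [hm] at hv hw
  obtain ⟨l, hl⟩ := iterCycle_eq q m k
  rw [hl] at hv hw
  exact ⟨_, hv, by simp, by rw [← List.cons_append, List.getLast?_concat], hw⟩

lemma IsChain.reaches {V : OneVASS Q} {γ : Q → List Q} (hγ : GammaChoice V γ)
    {C : Set (Q × ℕ)} (hC : IsChain V γ C) {c c' : Q × ℕ} (hc : c ∈ C) (hc' : c' ∈ C)
    (h : c.2 < c'.2) : Reaches V c c' := by
  obtain ⟨q, r, hq, -, hsub, hcond, -⟩ := hC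
  have := (hcond c hc c' hc' h).reaches hγ hq
  rwa [← show c = (q, c.2) from Prod.ext (hsub hc).2.1 rfl,
    ← show c' = (q, c'.2) from Prod.ext (hsub hc').2.1 rfl] at this

lemma IsChain.unbounded {V : OneVASS Q} {γ : Q → List Q} (hγ : GammaChoice V γ)
    {C : Set (Q × ℕ)} (hC : IsChain V γ C) (hb : ¬ chainBounded C) {c : Q × ℕ} (hc : c ∈ C) :
    Unbounded V c := by
  intro hfin
  obtain ⟨M, hM⟩ := (hfin.image Prod.snd).bddAbove
  refine hb ⟨max M c.2, ?_⟩
  rintro _ ⟨c', hc', rfl⟩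
  rcases lt_or_ge c.2 c'.2 with h | h
  · exact le_max_of_le_left (hM ⟨c', hC.reaches hγ hc hc' h, rfl⟩)
  · exact le_max_of_le_right h

/-- Every pairwise linked subset of a residue class extends to a chain. -/
lemma exists_isChainIn {V : OneVASS Q} {γ : Q → List Q} {q : Q} {r : ℕ} {S : Set (Q × ℕ)}
    (hS : S ⊆ resClass V γ q r) (hc : ChainCond V γ q S) : ∃ C, S ⊆ C ∧ IsChainIn V γ q r C := by
  obtain ⟨C, hSC, hC⟩ := zorn_subset_nonempty
    {T | T ⊆ resClass V γ q r ∧ ChainCond V γ q T} (fun c hcs hch _ => by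
      refine ⟨⋃₀ c, ⟨Set.sUnion_subset fun s hs => (hcs hs).1, ?_⟩,
        fun s hs => Set.subset_sUnion_of_mem hs⟩
      rintro x ⟨s, hs, hx⟩ y ⟨t, ht, hy⟩
      rcases hch.total hs ht with h | h
      · exact (hcs ht).2 x (h hx) y hy
      · exact (hcs hs).2 x hx y (h hy)) S ⟨hS, hc⟩
  exact ⟨C, hSC, hC.prop.1, hC.prop.2, fun C' h h1 h2 => (hC.le_of_ge ⟨h1, h2⟩ h).antisymm h⟩

/-- Beyond some counter value every configuration at a state of `Q₊` is in an unbounded chain. -/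
lemma exists_high_mem_unbounded_chain [Fintype Q] {V : OneVASS Q} {γ : Q → List Q}
    (hγ : GammaChoice V γ) :
    ∃ B : ℕ, ∀ q ∈ Qplus V, ∀ z ≥ B, ∃ C, IsChain V γ C ∧ ¬ chainBounded C ∧ (q, z) ∈ C := by
  obtain ⟨G, hG⟩ := (Set.finite_iUnion fun q => V.cofinite q).bddAbove
  obtain ⟨P, hP⟩ := (Set.finite_range fun q => (pmin V (γ q)).natAbs).bddAbove
  refine ⟨G + 1 + P, fun q hq z hz => ?_⟩
  have hPq : (pmin V (γ q)).natAbs ≤ P := hP ⟨q, rfl⟩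
  obtain ⟨hcyc, hpos, -⟩ := hγ q hq
  have hrun : ∀ y, z ≤ y → IsValidRun V (γ q) y := by
    intro y hy
    have key : ∀ i < (γ q).length, (G : ℤ) + 1 ≤ counterAt V y (γ q) i := by
      intro i hi
      have := pmin_le V (γ q) (i := i + 1) hi
      unfold counterAt
      omega
    refine ⟨⟨hcyc.1.1, fun i hi => by have := key i hi; omega⟩, fun i hi => ?_⟩
    by_contra hcon
    have h1 := key i hi
    have h2 : (counterAt V y (γ q) i).toNat ≤ G := hG (Set.mem_iUnion.2 ⟨_, hcon⟩)
    omega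
  obtain ⟨m, hm⟩ := hcyc.1.exists_eq
  have hW : ((Wnat V γ q : ℕ) : ℤ) = pathWeight V (γ q) := by
    simp [Wnat, hpos.le]
  have hW0 : 0 < Wnat V γ q := by omega
  let S : Set (Q × ℕ) := Set.range fun i : ℕ => (q, z + i * Wnat V γ q)
  have hS : S ⊆ resClass V γ q (z % Wnat V γ q) := by
    rintro _ ⟨i, rfl⟩
    refine ⟨⟨hq, ?_⟩, rfl, by simp⟩
    have : (0 : ℤ) ≤ i * Wnat V γ q := by positivity
    push_cast
    omega
  have hcond : ChainCond V γ q S := by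
    rintro _ ⟨i, rfl⟩ _ ⟨j, rfl⟩ hij
    have hij : i < j := by
      have : i * Wnat V γ q < j * Wnat V γ q := by simpa using hij
      exact lt_of_mul_lt_mul_right this (Nat.zero_le _)
    obtain ⟨k, rfl⟩ := Nat.exists_eq_add_of_lt hij
    have hle : z ≤ z + i * Wnat V γ q := Nat.le_add_right _ _
    rw [hm] at hrun hpos hW
    refine ⟨k, ?_, ?_⟩
    · rw [hm]
      exact isValidRun_iterCycle hpos.le (fun y hy => hrun y (hle.trans hy)) k
    · rw [hm, pathWeight_iterCycle, ← hW]
      push_cast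
      ring
  obtain ⟨C, hSC, hC⟩ := exists_isChainIn hS hcond
  refine ⟨C, ⟨q, _, hq, Nat.mod_lt _ hW0, hC⟩, ?_, hSC ⟨0, by simp⟩⟩
  rintro ⟨M, hM⟩
  have : z + (M + 1) * Wnat V γ q ≤ M := hM ⟨_, hSC ⟨M + 1, rfl⟩, rfl⟩
  nlinarith

lemma exists_infix_simple_cycle {l : List Q} (h : ¬ l.Nodup) :
    ∃ l₁ a m l₂, l = l₁ ++ a :: (m ++ a :: l₂) ∧ (a :: m).Nodup := by
  induction l with
  | nil => simp at h
  | cons b t ih =>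
    by_cases ht : t.Nodup
    · have hb : b ∈ t := by simpa [ht] using h
      obtain ⟨m, l₂, rfl⟩ := List.append_of_mem hb
      refine ⟨[], b, m, l₂, rfl, ?_⟩
      simp only [List.nodup_append, List.nodup_cons] at ht ⊢
      exact ⟨fun hbm => ht.2.2 b hbm b (by simp) rfl, ht.1⟩
    · obtain ⟨l₁, a, m, l₂, rfl, hn⟩ := ih ht
      exact ⟨b :: l₁, a, m, l₂, rfl, hn⟩

lemma pathWeight_le_length_mul {V : OneVASS Q} {K : ℕ} (hK : ∀ p q, V.w p q ≤ K) (l : List Q) :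
    pathWeight V l ≤ l.length * K := by
  induction l with
  | nil => simp [pathWeight]
  | cons a l ih =>
    cases l with
    | nil => simp [pathWeight_singleton]
    | cons b l =>
      rw [pathWeight_cons_cons, List.length_cons]
      have := hK a b
      push_cast at ih ⊢
      linarith

/-- A path of large weight visits a state on a positive-weight simple cycle. -/
lemma exists_mem_Qplus_of_heavy [Fintype Q] {V : OneVASS Q} {K : ℕ} (hK : ∀ p q, V.w p q ≤ K)
    {l : List Q} (hl : l.IsChain V.delta) (hw : (Fintype.card Q * K : ℤ) < pathWeight V l) :
    ∃ q ∈ l, q ∈ Qplus V := by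
  induction hn : l.length using Nat.strong_induction_on generalizing l with
  | _ n ih =>
    by_cases hnd : l.Nodup
    · have h1 := pathWeight_le_length_mul hK l
      have h2 : (l.length * K : ℤ) ≤ Fintype.card Q * K := by
        exact_mod_cast Nat.mul_le_mul_right K hnd.length_le_card
      omega
    · obtain ⟨l₁, a, m, l₂, rfl, hsimple⟩ := exists_infix_simple_cycle hnd
      have hw' : pathWeight V (l₁ ++ a :: (m ++ a :: l₂)) =
          pathWeight V (l₁ ++ a :: l₂) + pathWeight V (a :: (m ++ [a])) := by
        have := pathWeight_append V (a :: m) a l₂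
        rw [List.cons_append, List.cons_append] at this
        rw [pathWeight_append, this, pathWeight_append V l₁ a l₂]
        ring
      have e : l₁ ++ a :: (m ++ a :: l₂) = l₁ ++ (a :: (m ++ [a]) ++ l₂) := by simp
      by_cases hpos : 0 < pathWeight V (a :: (m ++ [a]))
      · refine ⟨a, by simp, _, ⟨⟨(isPath_iff V _).2 ⟨by simp, ?_⟩, by simp, by simp, ?_⟩, ?_⟩, hpos⟩
        · rw [e] at hl
          exact hl.right_of_append.left_of_append
        · rw [← List.cons_append, List.getLast?_concat]
        · rw [← List.cons_append, List.dropLast_concat]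
          exact hsimple
      · have hchain : (l₁ ++ a :: l₂).IsChain V.delta := by
          rw [List.isChain_split] at hl ⊢
          have h2 := hl.2
          rw [← List.cons_append, List.isChain_split] at h2
          exact ⟨hl.1, h2.2⟩
        obtain ⟨q, hq, hq'⟩ := ih (l₁ ++ a :: l₂).length (by rw [← hn]; simp) hchain
          (by omega) rfl
        refine ⟨q, ?_, hq'⟩
        simp only [List.mem_append, List.mem_cons] at hq ⊢
        tauto

lemma Reaches.exists_heavy_path {V : OneVASS Q} {K B : ℕ} (hK : ∀ p q, V.w p q ≤ K)
    {c c' : Q × ℕ} (h : Reaches V c c') :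
    c'.2 < B ∨ ∃ l : List Q, (l ++ [c'.1]).IsChain V.delta ∧
      (c'.2 : ℤ) ≤ c.2 + B + K + pathWeight V (l ++ [c'.1]) ∧
      ∀ q ∈ l ++ [c'.1], ∃ z ≥ B, Reaches V c (q, z) := by
  obtain ⟨hc, h⟩ := (reaches_iff V c c').1 h
  induction h with
  | refl =>
    rcases lt_or_ge c.2 B with hB | hB
    · exact .inl hB
    · refine .inr ⟨[], by simp, ?_, ?_⟩
      · simp [pathWeight_singleton]
        omega
      · simpa using ⟨c.2, hB, (reaches_iff V _ _).2 ⟨hc, .refl⟩⟩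
  | @tail x y hx hxy ih =>
    have hxr : Reaches V c x := (reaches_iff V _ _).2 ⟨hc, hx⟩
    have hyr : Reaches V c y := (reaches_iff V _ _).2 ⟨hc, hx.tail hxy⟩
    rcases lt_or_ge y.2 B with hB | hB
    · exact .inl hB
    obtain ⟨-, -, hd, hw⟩ := hxy
    have hk := hK x.1 y.1
    refine .inr ?_
    rcases ih hxr with hxB | ⟨l, hl, hlw, hlr⟩
    · refine ⟨[], by simp, ?_, ?_⟩
      · simp only [List.nil_append, pathWeight_singleton]
        omega
      · simpa using ⟨y.2, hB, hyr⟩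
    · refine ⟨l ++ [x.1], ?_, ?_, ?_⟩
      · rw [List.append_assoc, List.singleton_append, List.isChain_split]
        exact ⟨hl, by simpa using hd⟩
      · rw [List.append_assoc, List.singleton_append, pathWeight_append, pathWeight_cons_cons,
          pathWeight_singleton]
        omega
      · intro q hq
        rcases List.mem_append.1 hq with hq | hq
        · exact hlr q hq
        · obtain rfl : q = y.1 := by simpa using hq
          exact ⟨y.2, hB, hyr⟩

lemma Unbounded.exists_reaches_high [Fintype Q] {V : OneVASS Q} {c : Q × ℕ} (h : Unbounded V c)
    (B : ℕ) : ∃ q ∈ Qplus V, ∃ z ≥ B, Reaches V c (q, z) := by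
  obtain ⟨K, hK⟩ := (Set.finite_range fun p : Q × Q => (V.w p.1 p.2).natAbs).bddAbove
  have hK : ∀ p q, V.w p q ≤ K := fun p q => by
    have : (V.w p q).natAbs ≤ K := hK ⟨(p, q), rfl⟩
    omega
  obtain ⟨c', hc', hlarge⟩ : ∃ c', Reaches V c c' ∧ c.2 + B + K + Fintype.card Q * K < c'.2 := by
    by_contra! hcon
    refine h (((Set.finite_univ (α := Q)).prod
      (Set.finite_Iic (c.2 + B + K + Fintype.card Q * K))).subset fun x hx => ?_)
    exact ⟨trivial, hcon x hx⟩
  rcases hc'.exists_heavy_path (B := B) hK with hB | ⟨l, hl, hw, hr⟩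
  · omega
  · obtain ⟨q, hq, hq'⟩ := exists_mem_Qplus_of_heavy hK hl (by zify at hlarge; omega)
    exact ⟨q, hq', hr q hq⟩

lemma IsChain.subset_ConfPlus {V : OneVASS Q} {γ : Q → List Q} {C : Set (Q × ℕ)}
    (hC : IsChain V γ C) : C ⊆ ConfPlus V γ := by
  obtain ⟨q, r, -, -, hsub, -⟩ := hC
  exact fun c hc => (hsub hc).1

lemma RunLenTo.exists_reaches {V : OneVASS Q} {c : Q × ℕ} {S : Set (Q × ℕ)} {k : ℕ}
    (h : RunLenTo V c S k) : ∃ c' ∈ S, Reaches V c c' := by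
  obtain ⟨π, c', hc', hv, hr, -⟩ := h
  exact ⟨c', hc', π, hv, hr⟩

lemma Reaches.exists_runLenTo {V : OneVASS Q} {c c' : Q × ℕ} {S : Set (Q × ℕ)} (hc' : c' ∈ S)
    (h : Reaches V c c') : ∃ k, RunLenTo V c S k := by
  obtain ⟨π, hv, hr⟩ := h
  refine ⟨π.length - 1, π, c', hc', hv, hr, ?_⟩
  have : π ≠ [] := ((isPath_iff V π).1 hv.1.1).1
  have := List.length_pos_of_ne_nil this
  omega

lemma U_subset_succ (V : OneVASS Q) (γ : Q → List Q) (n : ℕ) : U V γ n ⊆ U V γ (n + 1) :=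
  Set.subset_sInter fun _ hS => Set.subset_union_left.trans hS.1

lemma Uprime_subset_U_succ (V : OneVASS Q) (γ : Q → List Q) (n : ℕ) :
    Uprime V γ (U V γ n) ⊆ U V γ (n + 1) :=
  Set.subset_sInter fun _ hS => Set.subset_union_right.trans hS.1

lemma U_subset_unbounded {V : OneVASS Q} {γ : Q → List Q} (hγ : GammaChoice V γ) (n : ℕ) :
    U V γ n ⊆ {c | c ∈ ConfPlus V γ ∧ Unbounded V c} := by
  induction n with
  | zero =>
    rintro c ⟨C, ⟨hC, hb⟩, hc⟩
    exact ⟨hC.subset_ConfPlus hc, hC.unbounded hγ hb hc⟩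
  | succ n ih =>
    refine Set.sInter_subset_of_mem ⟨Set.union_subset ih ?_, ?_⟩
    · rintro c ⟨hc, k, hk, -⟩
      obtain ⟨c', hc', hr⟩ := hk.exists_reaches
      exact ⟨hc.1, hr.unbounded (ih hc').2⟩
    · rintro C hC c ⟨hcS, hcC⟩ c' hc' hle
      refine ⟨hC.subset_ConfPlus hc', ?_⟩
      rcases hle.lt_or_eq with hlt | heq
      · exact (hC.reaches hγ hc' hcC hlt).unbounded hcS.2
      · obtain ⟨q, r, -, -, hsub, -⟩ := hC
        have : c' = c := Prod.ext ((hsub hc').2.1.trans (hsub hcC).2.1.symm) heq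
        exact this ▸ hcS.2

lemma Uprime_nonempty {V : OneVASS Q} {γ : Q → List Q} {S : Set (Q × ℕ)} {c : Q × ℕ} {k : ℕ}
    (hc : c ∈ ConfPlus V γ \ S) (hk : RunLenTo V c S k) : (Uprime V γ S).Nonempty := by
  classical
  have hex : ∃ k, ∃ c ∈ ConfPlus V γ \ S, RunLenTo V c S k := ⟨k, c, hc, hk⟩
  obtain ⟨c₀, hc₀, hk₀⟩ := Nat.find_spec hex
  exact ⟨c₀, hc₀, _, hk₀, fun c' hc' j hj => Nat.find_min' hex ⟨c', hc', hj⟩⟩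

/-- a configuration of `Conf₊` is unbounded iff it can reach a configuration lying
in some unbounded chain; consequently `⋃ n, U n` is the set of unbounded configurations
of `Conf₊`. -/
theorem unbounded_iff_reach_unbounded_chain_and_iUnion_U
    {Q : Type} [Fintype Q] (V : OneVASS Q) (hD : SingleGuard V)
    (γ : Q → List Q) (hγ : GammaChoice V γ) :
    (∀ c ∈ ConfPlus V γ,
      (Unbounded V c ↔
        ∃ C, IsChain V γ C ∧ ¬ chainBounded C ∧ ∃ c' ∈ C, Reaches V c c')) ∧
    (⋃ n, U V γ n) = {c | c ∈ ConfPlus V γ ∧ Unbounded V c} := by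
  obtain ⟨B, hB⟩ := exists_high_mem_unbounded_chain hγ
  have hreach : ∀ c, Unbounded V c →
      ∃ C, IsChain V γ C ∧ ¬ chainBounded C ∧ ∃ c' ∈ C, Reaches V c c' := by
    intro c hc
    obtain ⟨q, hq, z, hz, hr⟩ := hc.exists_reaches_high B
    obtain ⟨C, hC, hb, hmem⟩ := hB q hq z hz
    exact ⟨C, hC, hb, _, hmem, hr⟩
  refine ⟨fun c _ => ⟨hreach c, ?_⟩, (Set.iUnion_subset (U_subset_unbounded hγ)).antisymm ?_⟩
  · rintro ⟨C, hC, hb, c', hc', hr⟩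
    exact hr.unbounded (hC.unbounded hγ hb hc')
  · rintro c ⟨hc, hunb⟩
    by_contra hcU
    simp only [Set.mem_iUnion, not_exists] at hcU
    have hmono : Monotone (U V γ) := monotone_nat_of_le_succ (U_subset_succ V γ)
    have hfin : (ConfPlus V γ \ U V γ 0).Finite := by
      refine ((Set.finite_univ (α := Q)).prod (Set.finite_Iio B)).subset fun x hx => ?_
      refine ⟨trivial, ?_⟩
      by_contra hxB
      obtain ⟨C, hC, hb, hmem⟩ := hB x.1 hx.1.1 x.2 (not_lt.1 hxB)
      exact hx.2 (Set.mem_sUnion.2 ⟨C, ⟨hC, hb⟩, hmem⟩)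
    obtain ⟨C, hC, hb, c', hc', hr⟩ := hreach c hunb
    have hnew : ∀ n, ∃ x, x ∈ ConfPlus V γ \ U V γ n ∧ x ∈ U V γ (n + 1) := by
      intro n
      have hc'n : c' ∈ U V γ n := hmono (Nat.zero_le n) (Set.mem_sUnion.2 ⟨C, ⟨hC, hb⟩, hc'⟩)
      obtain ⟨k, hk⟩ := hr.exists_runLenTo hc'n
      obtain ⟨x, hx⟩ := Uprime_nonempty ⟨hc, hcU n⟩ hk
      exact ⟨x, hx.1, Uprime_subset_U_succ V γ n hx⟩
    choose x hx hx' using hnew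
    have hmem : ∀ n, x n ∈ ConfPlus V γ \ U V γ 0 := fun n =>
      ⟨(hx n).1, fun h => (hx n).2 (hmono (Nat.zero_le n) h)⟩
    refine Set.infinite_of_injective_forall_mem (fun i j hij => ?_) hmem hfin
    by_contra hne
    rcases lt_or_gt_of_ne hne with h | h
    · exact (hx j).2 (hmono h (hij ▸ hx' i))
    · exact (hx i).2 (hmono h (hij ▸ hx' j))

end VASSPaper
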